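/- Let W be the Weyl group of type D_n (Bourbaki labeling, with s_{n−1}, s_n the two fork nodes) and let J ⊂ S be a subset whose connected components have types A_{n₁},…,A_{n_r}, together with possibly one component of type D_l containing both s_{n−1} and s_n (set l = 0 if this component is absent, otherwise l ≥ 2). Set k = Σⱼ ⌈nⱼ/2⌉ and assume 2k − 1 ≤ n − 2. Then w_J is conjugate in W to (s₁·s₃·⋯·s_{2k−1})·w_{D_l}, where w_{D_l} denotes the longest element of the parabolic subgroup generated by {s_{n−l+1}, …, s_n} (and equals the identity if l = 0). -/

import Mathlib

open scoped Classical

namespace CoxeterSystem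

variable {B : Type*} {W : Type*} [Group W] {M : CoxeterMatrix B} (cs : CoxeterSystem M W)

/-- The Bruhat order on a Coxeter group: `x ≤ y` iff `y` can be obtained from `x` by
successively multiplying on the right by reflections, each multiplication strictly
increasing the length. -/
def bruhatLE (x y : W) : Prop :=
  Relation.ReflTransGen
    (fun a b => (∃ t, cs.IsReflection t ∧ b = a * t) ∧ cs.length a < cs.length b) x y

/-- the reflection length `ℓ_R(w)` : the minimal number of reflections whose product
is `w` -/
noncomputable def reflLen (w : W) : ℕ :=
  sInf {n | ∃ l : List W, l.length = n ∧ (∀ t ∈ l, cs.IsReflection t) ∧ l.prod = w}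

/-- the standard parabolic subgroup `W_K` generated by the simple reflections in `K` -/
def parabolic (K : Set B) : Subgroup W := Subgroup.closure (cs.simple '' K)

/-- `w` is the longest element of the standard parabolic subgroup `W_K` -/
def IsLongestOf (K : Set B) (w : W) : Prop :=
  w ∈ cs.parabolic K ∧ ∀ u ∈ cs.parabolic K, cs.length u ≤ cs.length w

/-- `w` is a minimal length representative of its coset in `W_K \ W` -/
def IsMinRep (K : Set B) (w : W) : Prop :=
  ∀ u ∈ cs.parabolic K, cs.length w ≤ cs.length (u * w)

end CoxeterSystem

/-- Adjacency in the Coxeter–Dynkin diagram of type `Dₙ` with Bourbaki labelling, where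
the vertex labelled `k` (`1 ≤ k ≤ n`) is `k − 1 : Fin n`: the vertices `s_1, …, s_{n−2}`
form a chain, and the two fork nodes `s_{n−1}`, `s_n` are both joined to `s_{n−2}`. -/
def DAdj (n : ℕ) (i j : Fin n) : Prop :=
  (((i : ℕ) + 1 = (j : ℕ) ∨ (j : ℕ) + 1 = (i : ℕ)) ∧
    ¬((i : ℕ) = n - 2 ∧ (j : ℕ) = n - 1) ∧ ¬((j : ℕ) = n - 2 ∧ (i : ℕ) = n - 1))
  ∨ ((i : ℕ) = n - 3 ∧ (j : ℕ) = n - 1) ∨ ((j : ℕ) = n - 3 ∧ (i : ℕ) = n - 1)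

namespace CoxeterSystem

variable {B W V : Type*} [Group W] {M : CoxeterMatrix B} [AddCommGroup V]

/-- The map `v ↦ v - α(v) b` attached to a linear form `α` and a vector `b`. -/
def rootReflection (α : V →+ ℤ) (b : V) : Function.End V := fun v => v - α v • b

/-- Linear forms `α i` and vectors `b i` whose pairings are the Cartan integers of the simply
laced Coxeter matrix `M`. -/
structure IsSimplyLacedRealization (M : CoxeterMatrix B) (α : B → V →+ ℤ) (b : B → V) :
    Prop where
  pairing_self : ∀ i, α i (b i) = 2
  pairing_ne : ∀ i j, i ≠ j →
    (M i j = 2 ∧ α i (b j) = 0 ∧ α j (b i) = 0) ∨ (M i j = 3 ∧ α i (b j) = -1 ∧ α j (b i) = -1)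

theorem rootReflection_apply (α : V →+ ℤ) (b v : V) : rootReflection α b v = v - α v • b := rfl

theorem rootReflection_mul_self {α : V →+ ℤ} {b : V} (h : α b = 2) :
    rootReflection α b * rootReflection α b = 1 := by
  funext v
  change rootReflection α b (rootReflection α b v) = v
  simp only [rootReflection_apply, map_sub, map_zsmul, h, smul_eq_mul]
  module

theorem rootReflection_mul_comm {α β : V →+ ℤ} {b c : V} (h : α c = 0) (h' : β b = 0) :
    rootReflection α b * rootReflection β c = rootReflection β c * rootReflection α b := by
  funext v
  change rootReflection α b (rootReflection β c v) = rootReflection β c (rootReflection α b v)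
  simp only [rootReflection_apply, map_sub, map_zsmul, h, h', smul_eq_mul]
  module

theorem rootReflection_braid {α β : V →+ ℤ} {b c : V} (hb : α b = 2) (hc : β c = 2)
    (h : α c = -1) (h' : β b = -1) :
    rootReflection α b * rootReflection β c * rootReflection α b =
      rootReflection β c * rootReflection α b * rootReflection β c := by
  funext v
  change rootReflection α b (rootReflection β c (rootReflection α b v)) =
    rootReflection β c (rootReflection α b (rootReflection β c v))
  simp only [rootReflection_apply, map_sub, map_zsmul, h, h', hb, hc, smul_eq_mul]
  module

theorem IsSimplyLacedRealization.isLiftable {α : B → V →+ ℤ} {b : B → V}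
    (hr : IsSimplyLacedRealization M α b) :
    M.IsLiftable fun i => rootReflection (α i) (b i) := by
  intro i j
  beta_reduce
  have hi := rootReflection_mul_self (hr.pairing_self i)
  have hj := rootReflection_mul_self (hr.pairing_self j)
  by_cases hij : i = j
  · subst hij
    rw [M.diagonal, pow_one, hi]
  rcases hr.pairing_ne i j hij with ⟨hM, h, h'⟩ | ⟨hM, h, h'⟩
  · have hc := rootReflection_mul_comm h h'
    rw [hM, pow_two]
    nth_rw 2 [hc]
    rw [mul_assoc, ← mul_assoc _ _ (rootReflection (α i) (b i)), hj, one_mul, hi]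
  · have hb := rootReflection_braid (hr.pairing_self i) (hr.pairing_self j) h h'
    rw [hM, pow_succ, pow_two]
    generalize rootReflection (α i) (b i) = x at *
    generalize rootReflection (α j) (b j) = y at *
    calc x * y * (x * y) * (x * y) = x * y * x * (y * x * y) := by simp only [mul_assoc]
      _ = x * y * (x * x) * y * x := by rw [← hb]; simp only [mul_assoc]
      _ = 1 := by rw [hi, mul_one, mul_assoc x, hj, mul_one, hi]

/-- The action of a Coxeter group on a simply laced realization. -/
noncomputable def realizationHom (cs : CoxeterSystem M W) {α : B → V →+ ℤ} {b : B → V}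
    (hr : IsSimplyLacedRealization M α b) : W →* Function.End V :=
  cs.lift ⟨_, hr.isLiftable⟩

section Positivity

variable (cs : CoxeterSystem M W) {α : B → V →+ ℤ} {b : B → V}
  (hr : IsSimplyLacedRealization M α b)

theorem realizationHom_simple (i : B) (v : V) :
    cs.realizationHom hr (cs.simple i) v = v - α i v • b i :=
  congrFun (cs.lift_apply_simple hr.isLiftable i) v

theorem realizationHom_mul (w u : W) (v : V) :
    cs.realizationHom hr (w * u) v = cs.realizationHom hr w (cs.realizationHom hr u v) := by
  rw [map_mul]; rfl

theorem realizationHom_one (v : V) : cs.realizationHom hr 1 v = v := by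
  rw [map_one]; rfl

theorem realizationHom_inv_mul_simple (w : W) (i : B) (v : V) :
    cs.realizationHom hr (w * cs.simple i)⁻¹ v =
      cs.realizationHom hr w⁻¹ v - α i (cs.realizationHom hr w⁻¹ v) • b i := by
  rw [mul_inv_rev, inv_simple, realizationHom_mul, realizationHom_simple]

theorem pairing_pos_of_not_isRightDescent {ρ : V} (hρ : ∀ i, 0 < α i ρ) (w : W) (i : B)
    (h : ¬cs.IsRightDescent w i) : 0 < α i (cs.realizationHom hr w⁻¹ ρ) := by
  induction hl : cs.length w using Nat.strong_induction_on generalizing w i with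
  | _ d ih =>
  subst hl
  by_cases hw : w = 1
  · subst hw
    rw [inv_one, realizationHom_one]
    exact hρ i
  obtain ⟨j, hj⟩ := cs.exists_rightDescent_of_ne_one hw
  have hij : i ≠ j := by rintro rfl; exact h hj
  rw [not_isRightDescent_iff] at h
  obtain ⟨v, rfl⟩ : ∃ v, w = v * cs.simple j := ⟨w * cs.simple j, by simp⟩
  rw [isRightDescent_iff, simple_mul_simple_cancel_right] at hj
  have hvj : ¬cs.IsRightDescent v j := by rw [not_isRightDescent_iff, hj]
  have key := ih _ (by omega) v j hvj rfl
  rw [realizationHom_inv_mul_simple, map_sub, map_zsmul, smul_eq_mul]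
  have hpow := cs.simple_mul_simple_pow i j
  rcases hr.pairing_ne i j hij with ⟨hM, h0, -⟩ | ⟨hM, h1, h1'⟩
  · have hcomm : cs.simple j * cs.simple i = cs.simple i * cs.simple j := by
      rw [hM, pow_two, mul_eq_one_iff_eq_inv, mul_inv_rev, inv_simple, inv_simple] at hpow
      exact hpow.symm
    have := ih _ (by omega) v i (by
      rw [not_isRightDescent_iff]
      rw [mul_assoc, hcomm, ← mul_assoc] at h
      have h₁ := cs.length_mul_simple v i
      have h₂ := cs.length_mul_simple (v * cs.simple i) j
      omega) rfl
    rw [h0]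
    linarith
  · rw [h1]
    by_cases hvi : cs.IsRightDescent v i
    · obtain ⟨u, rfl⟩ : ∃ u, v = u * cs.simple i := ⟨v * cs.simple i, by simp⟩
      rw [isRightDescent_iff, simple_mul_simple_cancel_right] at hvi
      have hbraid : cs.simple i * cs.simple j * cs.simple i =
          cs.simple j * cs.simple i * cs.simple j := by
        rw [hM, pow_succ, pow_two, mul_eq_one_iff_eq_inv, mul_inv_rev, inv_simple,
          inv_simple] at hpow
        rw [← mul_left_inj (cs.simple j), mul_assoc _ _ (cs.simple j), hpow]
        simp
      have := ih _ (by omega) u j (by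
        rw [not_isRightDescent_iff]
        rw [mul_assoc, mul_assoc, ← mul_assoc (cs.simple i), hbraid, ← mul_assoc,
          ← mul_assoc] at h
        have h₁ := cs.length_mul_simple u j
        have h₂ := cs.length_mul_simple (u * cs.simple j) i
        have h₃ := cs.length_mul_simple (u * cs.simple j * cs.simple i) j
        omega) rfl
      rw [realizationHom_inv_mul_simple, map_sub, map_zsmul, smul_eq_mul, map_sub, map_zsmul,
        smul_eq_mul, h1', hr.pairing_self]
      linarith
    · have := ih _ (by omega) v i hvi rfl
      linarith

theorem pairing_neg_of_isRightDescent {ρ : V} (hρ : ∀ i, 0 < α i ρ) (w : W) (i : B)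
    (h : cs.IsRightDescent w i) : α i (cs.realizationHom hr w⁻¹ ρ) < 0 := by
  have := cs.pairing_pos_of_not_isRightDescent hr hρ _ i
    (cs.isRightDescent_iff_not_isRightDescent_mul.1 h)
  rw [realizationHom_inv_mul_simple, map_sub, map_zsmul, smul_eq_mul, hr.pairing_self] at this
  linarith

theorem eq_of_realizationHom_inv_eq {ρ : V} (hρ : ∀ i, 0 < α i ρ) {w u : W}
    (h : cs.realizationHom hr w⁻¹ ρ = cs.realizationHom hr u⁻¹ ρ) : w = u := by
  by_contra hne
  have hwu : w * u⁻¹ ≠ 1 := fun h' => hne (mul_inv_eq_one.1 h')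
  obtain ⟨i, hi⟩ := cs.exists_rightDescent_of_ne_one hwu
  have hneg := cs.pairing_neg_of_isRightDescent hr hρ _ i hi
  rw [mul_inv_rev, inv_inv, realizationHom_mul, h, ← realizationHom_mul, mul_inv_cancel,
    realizationHom_one] at hneg
  exact absurd (hρ i) hneg.not_gt

theorem IsLongestOf.isRightDescent {K : Set B} {w : W} (hw : cs.IsLongestOf K w) {i : B}
    (hi : i ∈ K) : cs.IsRightDescent w i := by
  have := hw.2 _ (mul_mem hw.1 (Subgroup.subset_closure ⟨i, hi, rfl⟩))
  have := cs.length_mul_simple_ne w i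
  unfold IsRightDescent
  omega

/-- A property of vectors preserved by the simple reflections in `K` is preserved by `W_K`. -/
theorem realizationHom_of_mem_parabolic {K : Set B} {P : V → Prop}
    (hP : ∀ i ∈ K, ∀ v, P v → P (v - α i v • b i)) {w : W} (hw : w ∈ cs.parabolic K) {v : V}
    (hv : P v) : P (cs.realizationHom hr w v) := by
  suffices ∀ v, P v ↔ P (cs.realizationHom hr w v) from (this v).1 hv
  clear hv v
  induction hw using Subgroup.closure_induction with
  | mem x hx =>
    obtain ⟨i, hi, rfl⟩ := hx
    intro v
    refine ⟨fun h => ?_, fun h => ?_⟩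
    · rw [realizationHom_simple]
      exact hP i hi v h
    · have := hP i hi _ h
      rwa [← realizationHom_simple cs hr, ← realizationHom_mul, simple_mul_simple_self,
        realizationHom_one] at this
  | one => simp [realizationHom_one]
  | mul x y _ _ hx hy => exact fun v => by rw [realizationHom_mul, ← hx, ← hy]
  | inv x _ hx =>
    exact fun v => by
      rw [hx (cs.realizationHom hr x⁻¹ v), ← realizationHom_mul, mul_inv_cancel,
        realizationHom_one]

end Positivity

end CoxeterSystem

namespace TypeD

/-- The simple linear forms of type `Dₙ`, with 0-based labels and coordinates:
`v_i - v_{i+1}` for `i < n - 1`, and `v_{n-2} + v_{n-1}` for the last label. -/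
def simpleForm (n : ℕ) (i : Fin n) : (ℕ → ℤ) →+ ℤ :=
  if (i : ℕ) + 1 < n then
    Pi.evalAddMonoidHom (fun _ : ℕ => ℤ) (i : ℕ) - Pi.evalAddMonoidHom (fun _ : ℕ => ℤ) (i + 1)
  else Pi.evalAddMonoidHom (fun _ : ℕ => ℤ) (n - 2) + Pi.evalAddMonoidHom (fun _ : ℕ => ℤ) (n - 1)

/-- The simple roots of type `Dₙ`. -/
def simpleRoot (n : ℕ) (i : Fin n) : ℕ → ℤ := fun c =>
  if (i : ℕ) + 1 < n then (if c = i then 1 else 0) - (if c = i + 1 then 1 else 0)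
  else (if c = n - 2 then 1 else 0) + (if c = n - 1 then 1 else 0)

theorem simpleForm_of_lt {n : ℕ} {i : Fin n} (h : (i : ℕ) + 1 < n) (v : ℕ → ℤ) :
    simpleForm n i v = v i - v (i + 1) := by
  simp [simpleForm, h]

theorem simpleForm_of_not_lt {n : ℕ} {i : Fin n} (h : ¬(i : ℕ) + 1 < n) (v : ℕ → ℤ) :
    simpleForm n i v = v (n - 2) + v (n - 1) := by
  simp [simpleForm, h]

theorem simpleForm_apply {n : ℕ} (i : Fin n) (v : ℕ → ℤ) :
    simpleForm n i v = if (i : ℕ) + 1 < n then v i - v (i + 1) else v (n - 2) + v (n - 1) := by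
  split_ifs with h
  · exact simpleForm_of_lt h v
  · exact simpleForm_of_not_lt h v

theorem reflection_of_lt {n : ℕ} {i : Fin n} (h : (i : ℕ) + 1 < n) (v : ℕ → ℤ) :
    v - simpleForm n i v • simpleRoot n i = v ∘ Equiv.swap (i : ℕ) (i + 1) := by
  funext c
  simp only [Pi.sub_apply, Pi.smul_apply, smul_eq_mul, simpleForm_of_lt h, simpleRoot, h,
    if_true, Function.comp_apply, Equiv.swap_apply_def]
  split_ifs <;> first | omega | (subst_vars; ring)

theorem reflection_of_not_lt {n : ℕ} (hn : 2 ≤ n) {i : Fin n} (h : ¬(i : ℕ) + 1 < n) (v : ℕ → ℤ)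
    (c : ℕ) :
    (v - simpleForm n i v • simpleRoot n i) c =
      if c = n - 2 then -v (n - 1) else if c = n - 1 then -v (n - 2) else v c := by
  simp only [Pi.sub_apply, Pi.smul_apply, smul_eq_mul, simpleForm_of_not_lt h, simpleRoot, h,
    if_false]
  split_ifs <;> first | omega | (subst_vars; ring)

theorem isSimplyLacedRealization {n : ℕ} (hn : 4 ≤ n) {M : CoxeterMatrix (Fin n)}
    (hM : ∀ i j : Fin n, i ≠ j →
      (DAdj n i j → M.M i j = 3) ∧ (¬DAdj n i j → M.M i j = 2)) :
    CoxeterSystem.IsSimplyLacedRealization M (simpleForm n) (simpleRoot n) where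
  pairing_self i := by
    rw [simpleForm_apply]
    simp only [simpleRoot]
    split_ifs <;> omega
  pairing_ne i j hij := by
    have hij' : (i : ℕ) ≠ j := fun h => hij (Fin.ext h)
    have hi := i.isLt
    have hj := j.isLt
    rw [simpleForm_apply, simpleForm_apply]
    simp only [simpleRoot]
    by_cases h : DAdj n i j
    · refine .inr ⟨(hM i j hij).1 h, ?_⟩
      unfold DAdj at h
      by_cases h₁ : (i : ℕ) + 1 < n <;> by_cases h₂ : (j : ℕ) + 1 < n <;>
        simp only [h₁, h₂, if_true, if_false] <;> constructor <;> omega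
    · refine .inl ⟨(hM i j hij).2 h, ?_⟩
      unfold DAdj at h
      by_cases h₁ : (i : ℕ) + 1 < n <;> by_cases h₂ : (j : ℕ) + 1 < n <;>
        simp only [h₁, h₂, if_true, if_false] <;> constructor <;> omega

/-- Half the sum of the positive roots of type `Dₙ`. -/
def weylVector (n : ℕ) : ℕ → ℤ := fun c => n - 1 - c

theorem simpleForm_weylVector_pos {n : ℕ} (hn : 2 ≤ n) (i : Fin n) :
    0 < simpleForm n i (weylVector n) := by
  rw [simpleForm_apply]
  simp only [weylVector]
  split_ifs <;> omega

/-- Intervals `[a_j - 1, a_j + nn_j - 1]` of coordinates below `N`, separated from one another: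
the supports of components of type `A_{nn_j}` starting at the label `a_j`. -/
structure IsBlockData (N : ℕ) {r : ℕ} (a nn : Fin r → ℕ) : Prop where
  one_le : ∀ j, 1 ≤ a j
  le : ∀ j, a j + nn j ≤ N
  sep : ∀ i j : Fin r, (i : ℕ) < (j : ℕ) → a i + nn i + 1 ≤ a j

/-- The labels of the simple reflections in components of type `A` given by `a`, `nn` and one
component of type `D_l`. -/
def labels (n l : ℕ) {r : ℕ} (a nn : Fin r → ℕ) : Set (Fin n) :=
  {i : Fin n | (∃ j, a j ≤ (i : ℕ) + 1 ∧ (i : ℕ) + 1 < a j + nn j) ∨ (2 ≤ l ∧ n - l ≤ (i : ℕ))}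

theorem IsBlockData.eq_of_mem {N r : ℕ} {a nn : Fin r → ℕ} (h : IsBlockData N a nn) {c : ℕ}
    {j j' : Fin r} (hj : a j ≤ c + 1) (hj₁ : c < a j + nn j) (hj' : a j' ≤ c + 1)
    (hj₁' : c < a j' + nn j') : j = j' := by
  by_contra hne
  rcases lt_or_gt_of_ne hne with hlt | hlt
  · have := h.sep _ _ hlt
    omega
  · have := h.sep _ _ hlt
    omega

section Longest

variable {n l r : ℕ} {a nn : Fin r → ℕ}

/-- Coordinates not involved in the reflection with label `i` are unchanged. -/
theorem reflection_apply_of_ne (hn : 2 ≤ n) {i : Fin n} (v : ℕ → ℤ) {c : ℕ}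
    (h : (i : ℕ) + 1 < n → c ≠ i ∧ c ≠ i + 1) (h' : (i : ℕ) = n - 1 → c ≠ n - 2 ∧ c ≠ n - 1) :
    (v - simpleForm n i v • simpleRoot n i) c = v c := by
  have hi := i.isLt
  by_cases hlt : (i : ℕ) + 1 < n
  · rw [reflection_of_lt hlt, Function.comp_apply, Equiv.swap_apply_of_ne_of_ne (h hlt).1 (h hlt).2]
  · rw [reflection_of_not_lt hn hlt, if_neg (h' (by omega)).1, if_neg (h' (by omega)).2]

theorem block_bounds_reflection (hn : 2 ≤ n) (hl : l ≤ n) (hb : IsBlockData (n - l) a nn)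
    {i : Fin n} (hi : i ∈ labels n l a nn) (j : Fin r) (x y : ℤ) (v : ℕ → ℤ)
    (hv : ∀ c, a j ≤ c + 1 → c < a j + nn j → x ≤ v c ∧ v c ≤ y) :
    ∀ c, a j ≤ c + 1 → c < a j + nn j →
      x ≤ (v - simpleForm n i v • simpleRoot n i) c ∧
        (v - simpleForm n i v • simpleRoot n i) c ≤ y := by
  intro c hc hc'
  have hle := hb.le j
  rcases hi with ⟨j', hj', hj₁'⟩ | ⟨hl2, hi⟩
  · have hle' := hb.le j'
    rw [reflection_of_lt (by omega), Function.comp_apply, Equiv.swap_apply_def]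
    split_ifs with h₁ h₂
    · subst h₁
      obtain rfl := hb.eq_of_mem hc hc' hj' (by omega)
      exact hv _ (by omega) (by omega)
    · subst h₂
      obtain rfl := hb.eq_of_mem hc hc' (by omega) hj₁'
      exact hv _ (by omega) (by omega)
    · exact hv c hc hc'
  · rw [reflection_apply_of_ne hn v (by omega) (by omega)]
    exact hv c hc hc'

theorem tail_bounds_reflection (hn : 2 ≤ n) (hb : IsBlockData (n - l) a nn) (hl2 : 2 ≤ l)
    (hl : l ≤ n) {i : Fin n} (hi : i ∈ labels n l a nn) (v : ℕ → ℤ)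
    (hv : ∀ c, n - l ≤ c → c < n → |v c| < l) :
    ∀ c, n - l ≤ c → c < n → |(v - simpleForm n i v • simpleRoot n i) c| < l := by
  intro c hc hc'
  rcases hi with ⟨j', hj', hj₁'⟩ | ⟨-, hi⟩
  · have hle' := hb.le j'
    rw [reflection_apply_of_ne hn v (by omega) (by omega)]
    exact hv c hc hc'
  · by_cases hlt : (i : ℕ) + 1 < n
    · rw [reflection_of_lt hlt, Function.comp_apply, Equiv.swap_apply_def]
      split_ifs <;> exact hv _ (by omega) (by omega)
    · rw [reflection_of_not_lt hn hlt]
      split_ifs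
      · rw [abs_neg]
        exact hv _ (by omega) (by omega)
      · rw [abs_neg]
        exact hv _ (by omega) (by omega)
      · exact hv c hc hc'

theorem fixed_coordinate_reflection (hn : 2 ≤ n) (hl : l ≤ n) (hb : IsBlockData (n - l) a nn)
    {i : Fin n} (hi : i ∈ labels n l a nn) (c : ℕ)
    (hc : ∀ j, ¬(a j ≤ c + 1 ∧ c < a j + nn j)) (hc' : 2 ≤ l → n - l ≤ c → n ≤ c) (v : ℕ → ℤ) :
    (v - simpleForm n i v • simpleRoot n i) c = v c := by
  have hin := i.isLt
  rcases hi with ⟨j', hj', hj₁'⟩ | ⟨hl2, hi⟩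
  · have hle' := hb.le j'
    have := hc j'
    exact reflection_apply_of_ne hn v (by omega) (by omega)
  · have := hc' hl2
    exact reflection_apply_of_ne hn v (by omega) (by omega)

theorem eq_of_strictMono_block {v : ℕ → ℤ} {x m : ℕ} {y : ℤ}
    (hlt : ∀ c, x ≤ c → c < x + m → v c < v (c + 1)) (hlow : y ≤ v x) (hhigh : v (x + m) ≤ y + m)
    {d : ℕ} (hd : d ≤ m) : v (x + d) = y + d := by
  have low : ∀ d, d ≤ m → y + d ≤ v (x + d) := by
    intro d
    induction d with
    | zero => simpa using hlow
    | succ d ih =>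
      intro hd
      have h₁ := ih (by omega)
      have h₂ := hlt (x + d) (by omega) (by omega)
      rw [← add_assoc]
      push_cast
      omega
  have high : ∀ e, e ≤ m → v (x + (m - e)) ≤ y + (m - e : ℕ) := by
    intro e
    induction e with
    | zero => simpa using hhigh
    | succ e ih =>
      intro he
      have h₁ := ih (by omega)
      have h₂ := hlt (x + (m - (e + 1))) (by omega) (by omega)
      rw [show x + (m - (e + 1)) + 1 = x + (m - e) by omega] at h₂
      omega
  have h₁ := low d hd
  have h₂ := high (m - d) (by omega)
  rw [show m - (m - d) = d by omega] at h₂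
  omega

variable {W : Type*} [Group W] {M : CoxeterMatrix (Fin n)} (cs : CoxeterSystem M W)
  (hr : CoxeterSystem.IsSimplyLacedRealization M (simpleForm n) (simpleRoot n))

theorem longest_apply_block (hn : 2 ≤ n) (hl : l ≤ n) (hb : IsBlockData (n - l) a nn) {w : W}
    (hw : cs.IsLongestOf (labels n l a nn) w) (j : Fin r) {c : ℕ} (hc : a j ≤ c + 1)
    (hc' : c < a j + nn j) :
    cs.realizationHom hr w⁻¹ (weylVector n) c = weylVector n (2 * a j + nn j - 2 - c) := by
  have h1 := hb.one_le j
  have hle := hb.le j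
  have bounds := cs.realizationHom_of_mem_parabolic hr
    (P := fun v => ∀ c, a j ≤ c + 1 → c < a j + nn j →
      (n - a j - nn j : ℤ) ≤ v c ∧ v c ≤ n - a j)
    (fun i hi v hv => block_bounds_reflection hn hl hb hi j _ _ v hv) (inv_mem hw.1)
    (v := weylVector n) (fun c hc hc' => by simp only [weylVector]; omega)
  have hlt : ∀ c, a j - 1 ≤ c → c < a j - 1 + nn j →
      cs.realizationHom hr w⁻¹ (weylVector n) c <
        cs.realizationHom hr w⁻¹ (weylVector n) (c + 1) := by
    intro c hc hc'
    have := cs.pairing_neg_of_isRightDescent hr (simpleForm_weylVector_pos hn) w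
      ⟨c, by omega⟩ (hw.isRightDescent cs (.inl ⟨j, by simp only; omega, by simp only; omega⟩))
    rw [simpleForm_of_lt (by simp only; omega)] at this
    simp only at this
    omega
  have := eq_of_strictMono_block hlt (y := n - a j - nn j) (bounds _ (by omega) (by omega)).1
    (by have := (bounds (a j - 1 + nn j) (by omega) (by omega)).2; omega)
    (d := c - (a j - 1)) (by omega)
  rw [show a j - 1 + (c - (a j - 1)) = c by omega] at this
  rw [this]
  simp only [weylVector]
  omega

theorem longest_apply_tail (hn : 2 ≤ n) (hl : l ≤ n) (hl2 : 2 ≤ l)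
    (hb : IsBlockData (n - l) a nn) {w : W}
    (hw : cs.IsLongestOf (labels n l a nn) w) {c : ℕ} (hc : n - l ≤ c)
    (hc' : c < n) :
    cs.realizationHom hr w⁻¹ (weylVector n) c = -weylVector n c := by
  have bounds := cs.realizationHom_of_mem_parabolic hr
    (P := fun v => ∀ c, n - l ≤ c → c < n → |v c| < l)
    (fun i hi v hv => tail_bounds_reflection hn hb hl2 hl hi v hv) (inv_mem hw.1)
    (v := weylVector n) (fun c hc hc' => by simp only [weylVector, abs_lt]; omega)
  have hneg (i : Fin n) (hi : n - l ≤ (i : ℕ)) :=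
    cs.pairing_neg_of_isRightDescent hr (simpleForm_weylVector_pos hn) w i
      (hw.isRightDescent cs (.inr ⟨hl2, hi⟩))
  have hlast := hneg ⟨n - 1, by omega⟩ (by simp only; omega)
  rw [simpleForm_of_not_lt (by simp only; omega)] at hlast
  have hlt : ∀ c, n - l ≤ c → c < n - l + (l - 1) →
      cs.realizationHom hr w⁻¹ (weylVector n) c <
        cs.realizationHom hr w⁻¹ (weylVector n) (c + 1) := by
    intro c hc hc'
    have := hneg ⟨c, by omega⟩ hc
    rw [simpleForm_of_lt (by simp only; omega)] at this
    simp only at this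
    omega
  generalize cs.realizationHom hr w⁻¹ (weylVector n) = v at *
  have hlt₂ := hlt (n - 2) (by omega) (by omega)
  rw [show n - 2 + 1 = n - 1 by omega] at hlt₂
  have hfst := abs_lt.1 (bounds (n - l) le_rfl (by omega))
  have hpre {d : ℕ} (hd : d ≤ l - 2) : v (n - l + d) = -((l : ℤ) - 1) + d :=
    eq_of_strictMono_block (fun c hc hc' => hlt c hc (by omega)) (by omega)
      (by rw [show n - l + (l - 2) = n - 2 by omega]; omega) hd
  have hpen := hpre le_rfl
  rw [show n - l + (l - 2) = n - 2 by omega] at hpen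
  simp only [weylVector]
  by_cases hcn : c = n - 1
  · subst hcn
    omega
  · have := hpre (d := c - (n - l)) (by omega)
    rw [show n - l + (c - (n - l)) = c by omega] at this
    omega

theorem longest_apply_of_fixed (hn : 2 ≤ n) (hl : l ≤ n) (hb : IsBlockData (n - l) a nn) {w : W}
    (hw : cs.IsLongestOf (labels n l a nn) w) (c : ℕ)
    (hc : ∀ j, ¬(a j ≤ c + 1 ∧ c < a j + nn j)) (hc' : 2 ≤ l → n - l ≤ c → n ≤ c) :
    cs.realizationHom hr w⁻¹ (weylVector n) c = weylVector n c :=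
  cs.realizationHom_of_mem_parabolic hr (P := fun v => v c = weylVector n c)
    (fun _ hi v hv => (fixed_coordinate_reflection hn hl hb hi c hc hc' v).trans hv)
    (inv_mem hw.1) rfl

end Longest

section BlockReversal

variable {N r : ℕ} {a nn : Fin r → ℕ}

/-- `σ` reverses each of the coordinate intervals given by `a`, `nn` and fixes all other
coordinates. -/
structure IsBlockReversal (a nn : Fin r → ℕ) (σ : Equiv.Perm (Fin N)) : Prop where
  apply_of_mem : ∀ j (c : Fin N), a j ≤ (c : ℕ) + 1 → (c : ℕ) < a j + nn j →
    (σ c : ℕ) = 2 * a j + nn j - 2 - c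
  apply_of_forall_notMem : ∀ c : Fin N, (∀ j, ¬(a j ≤ (c : ℕ) + 1 ∧ (c : ℕ) < a j + nn j)) →
    σ c = c

theorem IsBlockReversal.mul_self (hb : IsBlockData N a nn) {σ : Equiv.Perm (Fin N)}
    (hσ : IsBlockReversal a nn σ) : σ * σ = 1 := by
  ext c
  rw [Equiv.Perm.mul_apply, Equiv.Perm.one_apply]
  by_cases h : ∃ j, a j ≤ (c : ℕ) + 1 ∧ (c : ℕ) < a j + nn j
  · obtain ⟨j, hj, hj'⟩ := h
    have h1 := hb.one_le j
    have h₁ := hσ.apply_of_mem j c hj hj'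
    have h₂ := hσ.apply_of_mem j (σ c) (by omega) (by omega)
    omega
  · push Not at h
    have hc := hσ.apply_of_forall_notMem c (by simpa using h)
    rw [hc, hc]

theorem exists_isBlockReversal (hb : IsBlockData N a nn) :
    ∃ σ : Equiv.Perm (Fin N), IsBlockReversal a nn σ := by
  have hf : ∀ c : Fin N, ∃ d : Fin N,
      (∀ j, a j ≤ (c : ℕ) + 1 → (c : ℕ) < a j + nn j → (d : ℕ) = 2 * a j + nn j - 2 - c) ∧
      ((∀ j, ¬(a j ≤ (c : ℕ) + 1 ∧ (c : ℕ) < a j + nn j)) → d = c) := by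
    intro c
    by_cases h : ∃ j, a j ≤ (c : ℕ) + 1 ∧ (c : ℕ) < a j + nn j
    · obtain ⟨j, hj, hj'⟩ := h
      have h1 := hb.one_le j
      have hle := hb.le j
      refine ⟨⟨2 * a j + nn j - 2 - c, by omega⟩, fun j' hj₁ hj₁' => ?_,
        fun h => absurd ⟨hj, hj'⟩ (h j)⟩
      obtain rfl := hb.eq_of_mem hj hj' hj₁ hj₁'
      rfl
    · exact ⟨c, fun j hj hj' => absurd ⟨j, hj, hj'⟩ h, fun _ => rfl⟩
  choose f hf hf' using hf
  have hinv : Function.Involutive f := by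
    intro c
    by_cases h : ∃ j, a j ≤ (c : ℕ) + 1 ∧ (c : ℕ) < a j + nn j
    · obtain ⟨j, hj, hj'⟩ := h
      have h1 := hb.one_le j
      have h₁ := hf c j hj hj'
      have h₂ := hf (f c) j (by omega) (by omega)
      omega
    · have := hf' c fun j hj => h ⟨j, hj⟩
      rw [this, this]
  exact ⟨hinv.toPerm, fun j c => hf c j, hf'⟩

theorem card_block_filter (hb : IsBlockData N a nn) (j : Fin r) :
    (Finset.univ.filter fun c : Fin N => (a j ≤ (c : ℕ) + 1 ∧ (c : ℕ) < a j + nn j) ∧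
      2 * a j + nn j - 2 ≠ 2 * c).card = 2 * ((nn j + 1) / 2) := by
  have h1 := hb.one_le j
  have hle := hb.le j
  rw [← Finset.card_map Fin.valEmbedding]
  rcases Nat.even_or_odd' (nn j) with ⟨q, hq | hq⟩
  · have : (Finset.univ.filter fun c : Fin N => (a j ≤ (c : ℕ) + 1 ∧ (c : ℕ) < a j + nn j) ∧
        2 * a j + nn j - 2 ≠ 2 * c).map Fin.valEmbedding =
        (Finset.Ico (a j - 1) (a j + nn j)).erase (a j - 1 + q) := by
      ext c
      simp only [Finset.mem_map, Finset.mem_filter, Finset.mem_univ, true_and,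
        Fin.valEmbedding_apply, Finset.mem_erase, Finset.mem_Ico]
      constructor
      · rintro ⟨d, hd, rfl⟩
        omega
      · exact fun h => ⟨⟨c, by omega⟩, by simp only; omega, rfl⟩
    rw [this, Finset.card_erase_of_mem (Finset.mem_Ico.2 (by omega)), Nat.card_Ico]
    omega
  · have : (Finset.univ.filter fun c : Fin N => (a j ≤ (c : ℕ) + 1 ∧ (c : ℕ) < a j + nn j) ∧
        2 * a j + nn j - 2 ≠ 2 * c).map Fin.valEmbedding =
        Finset.Ico (a j - 1) (a j + nn j) := by
      ext c
      simp only [Finset.mem_map, Finset.mem_filter, Finset.mem_univ, true_and,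
        Fin.valEmbedding_apply, Finset.mem_Ico]
      constructor
      · rintro ⟨d, hd, rfl⟩
        omega
      · exact fun h => ⟨⟨c, by omega⟩, by simp only; omega, rfl⟩
    rw [this, Nat.card_Ico]
    omega

theorem IsBlockReversal.card_support (hb : IsBlockData N a nn) {σ : Equiv.Perm (Fin N)}
    (hσ : IsBlockReversal a nn σ) : σ.support.card = 2 * ∑ j, (nn j + 1) / 2 := by
  have hsupp : σ.support = Finset.univ.biUnion fun j => Finset.univ.filter fun c : Fin N =>
      (a j ≤ (c : ℕ) + 1 ∧ (c : ℕ) < a j + nn j) ∧ 2 * a j + nn j - 2 ≠ 2 * c := by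
    ext c
    simp only [Equiv.Perm.mem_support, Finset.mem_biUnion, Finset.mem_univ, true_and,
      Finset.mem_filter]
    constructor
    · intro hc
      obtain ⟨j, hj⟩ : ∃ j, a j ≤ (c : ℕ) + 1 ∧ (c : ℕ) < a j + nn j := by
        by_contra h
        exact hc (hσ.apply_of_forall_notMem c fun j hj => h ⟨j, hj⟩)
      have := hσ.apply_of_mem j c hj.1 hj.2
      rw [Ne, Fin.ext_iff] at hc
      exact ⟨j, hj, by have := hb.one_le j; omega⟩
    · rintro ⟨j, hj, hc⟩ h
      have := hσ.apply_of_mem j c hj.1 hj.2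
      rw [h] at this
      have := hb.one_le j
      omega
  rw [hsupp, Finset.card_biUnion, Finset.mul_sum]
  · exact Finset.sum_congr rfl fun j _ => card_block_filter hb j
  · intro j _ j' _ hne
    rw [Function.onFun, Finset.disjoint_left]
    intro c hc hc'
    rw [Finset.mem_filter] at hc hc'
    exact hne (hb.eq_of_mem hc.2.1.1 hc.2.1.2 hc'.2.1.1 hc'.2.1.2)

theorem cycleType_eq_replicate_of_mul_self {α : Type*} [Fintype α] [DecidableEq α]
    {σ : Equiv.Perm α} (hσ : σ * σ = 1) {k : ℕ} (hk : σ.support.card = 2 * k) :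
    σ.cycleType = Multiset.replicate k 2 := by
  have h2 : ∀ m ∈ σ.cycleType, m = 2 := fun m hm =>
    le_antisymm (Nat.le_of_dvd two_pos ((Equiv.Perm.dvd_of_mem_cycleType hm).trans
      (orderOf_dvd_of_pow_eq_one (by rw [pow_two, hσ]))))
      (Equiv.Perm.two_le_of_mem_cycleType hm)
  have hrep := Multiset.eq_replicate_card.2 h2
  have hsum := σ.sum_cycleType
  rw [hrep, Multiset.sum_replicate, hk, smul_eq_mul] at hsum
  rw [hrep, show σ.cycleType.card = k by omega]

theorem IsBlockReversal.cycleType_eq (hb : IsBlockData N a nn) {σ : Equiv.Perm (Fin N)}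
    (hσ : IsBlockReversal a nn σ) :
    σ.cycleType = Multiset.replicate (∑ j, (nn j + 1) / 2) 2 :=
  cycleType_eq_replicate_of_mul_self (hσ.mul_self hb) (hσ.card_support hb)

end BlockReversal

section Realizes

variable {n N : ℕ} {W : Type*} [Group W] {M : CoxeterMatrix (Fin n)} (cs : CoxeterSystem M W)
  (hr : CoxeterSystem.IsSimplyLacedRealization M (simpleForm n) (simpleRoot n))

/-- The permutation of `ℕ` acting as `π` below `N` and trivially elsewhere. -/
def natPerm (π : Equiv.Perm (Fin N)) : Equiv.Perm ℕ := π.extendDomain Fin.equivSubtype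

theorem natPerm_of_lt (π : Equiv.Perm (Fin N)) {c : ℕ} (hc : c < N) :
    natPerm π c = π ⟨c, hc⟩ :=
  π.extendDomain_apply_image Fin.equivSubtype ⟨c, hc⟩

theorem natPerm_of_le (π : Equiv.Perm (Fin N)) {c : ℕ} (hc : N ≤ c) : natPerm π c = c :=
  π.extendDomain_apply_not_subtype Fin.equivSubtype hc.not_gt

theorem natPerm_mul (π π' : Equiv.Perm (Fin N)) : natPerm (π * π') = natPerm π * natPerm π' :=
  (Equiv.Perm.extendDomain_mul _ _ _).symm

/-- `g` permutes the coordinates of vectors through `π`. -/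
def Realizes (g : W) (π : Equiv.Perm (Fin N)) : Prop :=
  ∀ v : ℕ → ℤ, cs.realizationHom hr g⁻¹ v = v ∘ natPerm π

variable {cs hr}

theorem Realizes.mul {g g' : W} {π π' : Equiv.Perm (Fin N)} (h : Realizes cs hr g π)
    (h' : Realizes cs hr g' π') : Realizes cs hr (g * g') (π * π') := by
  intro v
  rw [mul_inv_rev, CoxeterSystem.realizationHom_mul, h, h', natPerm_mul]
  rfl

theorem Realizes.inv {g : W} {π : Equiv.Perm (Fin N)} (h : Realizes cs hr g π) :
    Realizes cs hr g⁻¹ π⁻¹ := by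
  intro v
  have hv : (v ∘ natPerm π⁻¹) ∘ natPerm π = v := by
    rw [Function.comp_assoc, ← Equiv.Perm.coe_mul, ← natPerm_mul, inv_mul_cancel, natPerm,
      Equiv.Perm.extendDomain_one]
    rfl
  nth_rw 1 [← hv]
  rw [← h, ← CoxeterSystem.realizationHom_mul, inv_inv, mul_inv_cancel,
    CoxeterSystem.realizationHom_one]

theorem Realizes.eq (hn : 2 ≤ n) {g g' : W} {π : Equiv.Perm (Fin N)} (h : Realizes cs hr g π)
    (h' : Realizes cs hr g' π) : g = g' :=
  cs.eq_of_realizationHom_inv_eq hr (simpleForm_weylVector_pos hn) ((h _).trans (h' _).symm)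

theorem realizes_one : Realizes cs hr 1 (1 : Equiv.Perm (Fin N)) := by
  intro v
  rw [inv_one, CoxeterSystem.realizationHom_one, natPerm, Equiv.Perm.extendDomain_one]
  rfl

variable (cs hr)

theorem exists_realizes (hN : N ≤ n) (π : Equiv.Perm (Fin N)) :
    ∃ g ∈ cs.parabolic {i : Fin n | (i : ℕ) + 1 < N}, Realizes cs hr g π := by
  cases N with
  | zero => exact ⟨1, one_mem _, by rw [Subsingleton.elim π 1]; exact realizes_one⟩
  | succ m =>
    have hπ : π ∈ Submonoid.closure
        (Set.range fun i : Fin m => Equiv.swap i.castSucc i.succ) := by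
      rw [Equiv.Perm.mclosure_swap_castSucc_succ]
      trivial
    induction hπ using Submonoid.closure_induction with
    | mem x hx =>
      obtain ⟨i, rfl⟩ := hx
      have hi := i.isLt
      refine ⟨cs.simple ⟨i, by omega⟩, Subgroup.subset_closure ⟨_, by simp, rfl⟩, fun v => ?_⟩
      rw [CoxeterSystem.inv_simple, CoxeterSystem.realizationHom_simple,
        reflection_of_lt (by simp only; omega)]
      congr 1
      funext c
      by_cases hc : c < m + 1
      · rw [natPerm_of_lt _ hc]
        simp only [Equiv.swap_apply_def, Fin.ext_iff, Fin.val_castSucc, Fin.val_succ]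
        split_ifs <;> simp
      · rw [natPerm_of_le _ (by omega), Equiv.swap_apply_of_ne_of_ne] <;> simp only <;> omega
    | one => exact ⟨1, one_mem _, realizes_one⟩
    | mul x y _ _ hx hy =>
      obtain ⟨g, hg, hgx⟩ := hx
      obtain ⟨g', hg', hgy⟩ := hy
      exact ⟨g * g', mul_mem hg hg', hgx.mul hgy⟩

/-- The product `s₁ s₃ ⋯ s_{2k-1}` exchanges the coordinates within the pairs `2m`, `2m + 1`. -/
theorem realizationHom_prod_simple {k : ℕ} (hk : 2 * k ≤ n) (hn : 0 < n) (v : ℕ → ℤ) (c : ℕ) :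
    cs.realizationHom hr ((List.range k).map
      (fun m => cs.simple (⟨2 * m % n, Nat.mod_lt _ hn⟩ : Fin n))).prod⁻¹ v c =
      v (if c < 2 * k then 4 * (c / 2) + 1 - c else c) := by
  induction k generalizing c with
  | zero => simp [CoxeterSystem.realizationHom_one]
  | succ k ih =>
    have hmod : 2 * k % n = 2 * k := Nat.mod_eq_of_lt (by omega)
    rw [List.range_succ, List.map_append, List.prod_append, List.map_singleton,
      List.prod_singleton, CoxeterSystem.realizationHom_inv_mul_simple,
      reflection_of_lt (by simp only; omega), Function.comp_apply, ih (by omega)]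
    simp only [hmod, Equiv.swap_apply_def]
    congr 1
    split_ifs <;> omega

theorem commute_of_mem_parabolic {B W : Type*} [Group W] {M : CoxeterMatrix B}
    (cs : CoxeterSystem M W) {K L : Set B} (h : ∀ i ∈ K, ∀ j ∈ L, M i j = 2) {x y : W}
    (hx : x ∈ cs.parabolic K) (hy : y ∈ cs.parabolic L) : Commute x y := by
  have hy' : y ∈ Subgroup.centralizer (cs.parabolic K : Set W) := by
    refine (Subgroup.closure_le _).2 ?_ hy
    rintro _ ⟨j, hj, rfl⟩
    refine Subgroup.centralizer_closure (cs.simple '' K) ▸ Subgroup.mem_centralizer_iff.2 ?_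
    rintro _ ⟨i, hi, rfl⟩
    have hpow := cs.simple_mul_simple_pow i j
    rwa [h i hi j hj, pow_two, mul_eq_one_iff_eq_inv, mul_inv_rev, cs.inv_simple,
      cs.inv_simple] at hpow
  exact Subgroup.mem_centralizer_iff.1 hy' x hx

end Realizes

section Main

variable {n l r : ℕ} {a nn : Fin r → ℕ} {W : Type*} [Group W] {M : CoxeterMatrix (Fin n)}
  (cs : CoxeterSystem M W)
  (hr : CoxeterSystem.IsSimplyLacedRealization M (simpleForm n) (simpleRoot n))

/-- The longest element of `W_J` is the longest element of the component of type `D_l` times the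
element reversing the blocks of type `A`. -/
theorem longest_eq_mul (hn : 2 ≤ n) (hl : l ≤ n) (hb : IsBlockData (n - l) a nn) {w d x : W}
    (hw : cs.IsLongestOf (labels n l a nn) w)
    (hd : cs.IsLongestOf (labels n l (Fin.elim0 : Fin 0 → ℕ) Fin.elim0) d)
    {σ : Equiv.Perm (Fin (n - l))} (hσ : IsBlockReversal a nn σ) (hx : Realizes cs hr x σ) :
    w = d * x := by
  have hb₀ : IsBlockData (n - l) (Fin.elim0 : Fin 0 → ℕ) Fin.elim0 :=
    ⟨fun j => j.elim0, fun j => j.elim0, fun j => j.elim0⟩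
  refine cs.eq_of_realizationHom_inv_eq hr (simpleForm_weylVector_pos hn) ?_
  rw [mul_inv_rev, CoxeterSystem.realizationHom_mul, hx]
  funext c
  rw [Function.comp_apply]
  by_cases hc : c < n - l
  · have hσc := (σ ⟨c, hc⟩).isLt
    rw [natPerm_of_lt σ hc, longest_apply_of_fixed cs hr hn hl hb₀ hd _ (fun j => j.elim0)
      (by omega)]
    by_cases h : ∃ j, a j ≤ c + 1 ∧ c < a j + nn j
    · obtain ⟨j, hj, hj'⟩ := h
      rw [longest_apply_block cs hr hn hl hb hw j hj hj', hσ.apply_of_mem j ⟨c, hc⟩ hj hj']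
    · have h' : ∀ j, ¬(a j ≤ c + 1 ∧ c < a j + nn j) := fun j hj => h ⟨j, hj⟩
      rw [longest_apply_of_fixed cs hr hn hl hb hw c h' (by omega),
        hσ.apply_of_forall_notMem ⟨c, hc⟩ h']
  · rw [natPerm_of_le σ (by omega)]
    by_cases hlc : 2 ≤ l ∧ c < n
    · rw [longest_apply_tail cs hr hn hl hlc.1 hb hw (by omega) hlc.2,
        longest_apply_tail cs hr hn hl hlc.1 hb₀ hd (by omega) hlc.2]
    · rw [longest_apply_of_fixed cs hr hn hl hb hw c
          (fun j => by have := hb.le j; omega) (by omega),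
        longest_apply_of_fixed cs hr hn hl hb₀ hd c (fun j => j.elim0) (by omega)]

theorem realizes_prod_simple {N k : ℕ} (hkN : 2 * k ≤ N) (hNn : N ≤ n) (hn : 0 < n)
    {τ : Equiv.Perm (Fin N)}
    (hτ : IsBlockReversal (fun m : Fin k => 2 * (m : ℕ) + 1) (fun _ => 1) τ) :
    Realizes cs hr ((List.range k).map
      (fun m => cs.simple (⟨2 * m % n, Nat.mod_lt _ hn⟩ : Fin n))).prod τ := by
  intro v
  funext c
  rw [realizationHom_prod_simple cs hr (by omega) hn, Function.comp_apply]
  congr 1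
  by_cases hc : c < N
  · rw [natPerm_of_lt τ hc]
    split_ifs with hck
    · rw [hτ.apply_of_mem ⟨c / 2, by omega⟩ ⟨c, hc⟩ (by simp only; omega) (by simp only; omega)]
      simp only
      omega
    · rw [hτ.apply_of_forall_notMem ⟨c, hc⟩ fun m => by have := m.isLt; simp only; omega]
  · rw [natPerm_of_le τ (by omega), if_neg (by omega)]

end Main

end TypeD

/-- Let `W` be the Weyl group of type `Dₙ` (Bourbaki labelling, with `s_{n−1}`, `s_n` the
two fork nodes) and let `J ⊆ S` be a subset whose connected components are intervals of
labels `[a_j, a_j + n_j − 1] ⊆ [1, n−1]` of types `A_{n_1}, …, A_{n_r}`, together with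
possibly one component `{s_{n−l+1}, …, s_n}` of type `D_l` containing both `s_{n−1}` and
`s_n` (`l = 0` if this component is absent, otherwise `l ≥ 2`). Set `k = Σⱼ ⌈n_j / 2⌉` and
assume `2k − 1 ≤ n − 2`. Then `w_J` is conjugate in `W` to `(s_1 s_3 ⋯ s_{2k−1}) w_{D_l}`,
where `w_{D_l}` is the longest element of the parabolic subgroup generated by
`{s_{n−l+1}, …, s_n}` (the identity if `l = 0`). -/
theorem stmt12 (n : ℕ) (hn : 4 ≤ n) {W : Type*} [Group W]
    {M : CoxeterMatrix (Fin n)} (cs : CoxeterSystem M W)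
    (hM : ∀ i j : Fin n, i ≠ j → (DAdj n i j → M.M i j = 3) ∧ (¬DAdj n i j → M.M i j = 2))
    (r : ℕ) (a nn : Fin r → ℕ) (l : ℕ)
    (hl : l = 0 ∨ 2 ≤ l) (hln : l ≤ n)
    (hnn : ∀ j, 0 < nn j) (ha1 : ∀ j, 1 ≤ a j)
    (hend : ∀ j, a j + nn j ≤ n)
    (hsep : ∀ j j' : Fin r, (j : ℕ) < (j' : ℕ) → a j + nn j + 1 ≤ a j')
    (hDsep : ∀ j, 2 ≤ l → a j + nn j + l ≤ n)
    (J : Set (Fin n))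
    (hJ : J = {i : Fin n | (∃ j, a j ≤ (i : ℕ) + 1 ∧ (i : ℕ) + 1 < a j + nn j) ∨
      (2 ≤ l ∧ n - l ≤ (i : ℕ))})
    (k : ℕ) (hk : k = ∑ j, (nn j + 1) / 2) (hk2 : 2 * k ≤ n - 1)
    (wJ : W) (hwJ : cs.IsLongestOf J wJ)
    (wDl : W) (hwDl : cs.IsLongestOf {i : Fin n | n - l ≤ (i : ℕ)} wDl) :
    IsConj wJ
      (((List.range k).map
        (fun m => cs.simple (⟨2 * m % n, Nat.mod_lt _ (by omega)⟩ : Fin n))).prod * wDl) := by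
  have hr := TypeD.isSimplyLacedRealization hn hM
  have hb : TypeD.IsBlockData (n - l) a nn := ⟨ha1, fun j => by
    have := hend j
    have := hDsep j
    omega, hsep⟩
  subst hk hJ
  obtain ⟨σ, hσ⟩ := TypeD.exists_isBlockReversal hb
  have hkN : 2 * ∑ j, (nn j + 1) / 2 ≤ n - l := by
    rw [← hσ.card_support hb]
    exact (Finset.card_le_univ _).trans_eq (Fintype.card_fin _)
  have hb' : TypeD.IsBlockData (n - l)
      (fun m : Fin (∑ j, (nn j + 1) / 2) => 2 * (m : ℕ) + 1) (fun _ => 1) :=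
    ⟨fun _ => by omega, fun m => by have := m.isLt; omega,
      fun m m' h => by omega⟩
  obtain ⟨τ, hτ⟩ := TypeD.exists_isBlockReversal hb'
  obtain ⟨γ, hγ⟩ := isConj_iff.1 (Equiv.Perm.isConj_iff_cycleType_eq.2
    (show σ.cycleType = τ.cycleType by
      rw [hσ.cycleType_eq hb, hτ.cycleType_eq hb']
      simp))
  obtain ⟨x, hx, hxσ⟩ := TypeD.exists_realizes cs hr (Nat.sub_le n l) σ
  obtain ⟨g, hg, hgγ⟩ := TypeD.exists_realizes cs hr (Nat.sub_le n l) γ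
  have hcomm {y : W} (hy : y ∈ cs.parabolic {i : Fin n | (i : ℕ) + 1 < n - l}) :
      Commute y wDl := by
    refine TypeD.commute_of_mem_parabolic cs (fun i hi j hj => ?_) hy hwDl.1
    simp only [Set.mem_ofPred_eq] at hi hj
    have hjn := j.isLt
    refine (hM i j fun h => ?_).2 ?_
    · rw [h] at hi
      omega
    · unfold DAdj
      omega
  have hwJ' : wJ = wDl * x := by
    refine TypeD.longest_eq_mul cs hr (by omega) hln hb hwJ ?_ hσ hxσ
    convert hwDl using 1
    ext i
    have hi := i.isLt
    simp only [TypeD.labels, Set.mem_ofPred_eq, IsEmpty.exists_iff, false_or]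
    omega
  have hprod := (TypeD.realizes_prod_simple cs hr hkN (Nat.sub_le n l) (by omega) hτ).eq
    (by omega) (hγ ▸ (hgγ.mul hxσ).mul hgγ.inv)
  rw [hprod, isConj_iff]
  refine ⟨g, ?_⟩
  rw [hwJ', (hcomm (mul_mem (mul_mem hg hx) (inv_mem hg))).eq, ← mul_assoc g, (hcomm hg).eq]
  simp only [mul_assoc]
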